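/- Let (X₁,𝔅₁,μ₁) and (X₂,𝔅₂,μ₂) be probability spaces and let Φ : L¹(X₁,μ₁) → L¹(X₂,μ₂) be a Markov embedding. Let (f_n)_{n≥1} ⊆ L¹(X₁,μ₁) be a sequence majorized by some g ∈ L¹(X₁,μ₁), i.e. |f_n| ≤ g μ₁-almost everywhere for all n. Then (f_n) converges to 0 pointwise μ₁-almost everywhere if and only if (Φf_n) converges to 0 pointwise μ₂-almost everywhere. -/

import Mathlib

open MeasureTheory Filter Topology

noncomputable section

/-- A real-linear map between `L¹` spaces which commutes with `|·|` commutes with `⊔`. -/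
theorem map_sup_of_map_abs {X₁ X₂ : Type*} [MeasurableSpace X₁] [MeasurableSpace X₂]
    {μ₁ : Measure X₁} {μ₂ : Measure X₂} (Φ : Lp ℝ 1 μ₁ →ₗ[ℝ] Lp ℝ 1 μ₂)
    (habs : ∀ h : Lp ℝ 1 μ₁, |Φ h| = Φ |h|) (h k : Lp ℝ 1 μ₁) :
    Φ (h ⊔ k) = Φ h ⊔ Φ k := by
  have e : (2 : ℕ) • Φ (h ⊔ k) = (2 : ℕ) • (Φ h ⊔ Φ k) := by
    rw [← map_nsmul, two_nsmul_sup_eq_add_add_abs_sub, two_nsmul_sup_eq_add_add_abs_sub,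
      map_add, map_add, ← habs, map_sub]
  rw [← Nat.cast_smul_eq_nsmul ℝ, ← Nat.cast_smul_eq_nsmul ℝ] at e
  exact smul_right_injective _ (by norm_num : ((2 : ℕ) : ℝ) ≠ 0) e

theorem map_partialSups_of_map_abs {X₁ X₂ : Type*} [MeasurableSpace X₁] [MeasurableSpace X₂]
    {μ₁ : Measure X₁} {μ₂ : Measure X₂} (Φ : Lp ℝ 1 μ₁ →ₗ[ℝ] Lp ℝ 1 μ₂)
    (habs : ∀ h : Lp ℝ 1 μ₁, |Φ h| = Φ |h|) (u : ℕ → Lp ℝ 1 μ₁) (k : ℕ) :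
    Φ (partialSups u k) = partialSups (fun n => Φ (u n)) k := by
  induction k with
  | zero => simp
  | succ k ih => rw [partialSups_add_one, partialSups_add_one, map_sup_of_map_abs Φ habs, ih]

theorem enorm_map_of_map_abs {X₁ X₂ : Type*} [MeasurableSpace X₁] [MeasurableSpace X₂]
    {μ₁ : Measure X₁} {μ₂ : Measure X₂} (Φ : Lp ℝ 1 μ₁ →ₗ[ℝ] Lp ℝ 1 μ₂)
    (hint : ∀ h : Lp ℝ 1 μ₁, ∫ x, (Φ h) x ∂μ₂ = ∫ x, h x ∂μ₁)
    (habs : ∀ h : Lp ℝ 1 μ₁, |Φ h| = Φ |h|) (h : Lp ℝ 1 μ₁) : ‖Φ h‖ₑ = ‖h‖ₑ := by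
  have key : ‖Φ h‖ = ‖h‖ := by
    rw [L1.norm_eq_integral_norm, L1.norm_eq_integral_norm]
    calc ∫ x, ‖(Φ h) x‖ ∂μ₂ = ∫ x, (|Φ h| : Lp ℝ 1 μ₂) x ∂μ₂ :=
          integral_congr_ae (Lp.coeFn_abs (Φ h)).symm
      _ = ∫ x, (|h| : Lp ℝ 1 μ₁) x ∂μ₁ := by rw [habs, hint]
      _ = ∫ x, ‖h x‖ ∂μ₁ := integral_congr_ae (Lp.coeFn_abs h)
  rw [← ofReal_norm, ← ofReal_norm, key]

theorem enorm_partialSups_abs_coeFn {X : Type*} [MeasurableSpace X] {μ : Measure X}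
    (u : ℕ → Lp ℝ 1 μ) (k : ℕ) :
    ∀ᵐ x ∂μ, ‖(partialSups (fun n => |u n|) k : Lp ℝ 1 μ) x‖ₑ =
      partialSups (fun n => ‖u n x‖ₑ) k := by
  suffices H : ∀ᵐ x ∂μ, 0 ≤ (partialSups (fun n => |u n|) k : Lp ℝ 1 μ) x ∧
      ‖(partialSups (fun n => |u n|) k : Lp ℝ 1 μ) x‖ₑ = partialSups (fun n => ‖u n x‖ₑ) k from
    H.mono fun _ hx => hx.2
  induction k with
  | zero =>
    filter_upwards [Lp.coeFn_abs (u 0)] with x hx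
    simp [hx]
  | succ k ih =>
    filter_upwards [ih, Lp.coeFn_abs (u (k + 1)),
      Lp.coeFn_sup (partialSups (fun n => |u n|) k) |u (k + 1)|] with x h₁ h₂ h₃
    rw [partialSups_add_one, partialSups_add_one, h₃, Pi.sup_apply, h₂, ← h₁.2]
    refine ⟨le_sup_of_le_left h₁.1, ?_⟩
    rw [Real.enorm_of_nonneg (le_sup_of_le_left h₁.1), Real.enorm_of_nonneg h₁.1,
      Real.enorm_eq_ofReal_abs]
    exact ENNReal.ofReal_mono.map_max

/-- For a dominated sequence in `L¹`, the integral of the upper limit of the absolute values is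
determined by the norms of finite lattice suprema. -/
theorem lintegral_limsup_enorm_eq {X : Type*} [MeasurableSpace X] {μ : Measure X}
    (u : ℕ → Lp ℝ 1 μ) (g : Lp ℝ 1 μ) (hmaj : ∀ n, |u n| ≤ g) :
    ∫⁻ x, limsup (fun n => ‖u n x‖ₑ) atTop ∂μ =
      ⨅ n, ⨆ k, ‖partialSups (fun i => |u (i + n)|) k‖ₑ := by
  have hm (n : ℕ) : Measurable fun x => ‖u n x‖ₑ := (Lp.stronglyMeasurable (u n)).enorm
  have hmP (n k : ℕ) : Measurable fun x => partialSups (fun i => ‖u (i + n) x‖ₑ) k := by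
    induction k with
    | zero => simpa using hm n
    | succ k ih =>
      simp only [partialSups_add_one]
      exact ih.sup (hm _)
  simp only [limsup_eq_iInf_iSup_of_nat']
  rw [lintegral_iInf (fun n => .iSup fun i => hm (i + n))]
  · congr! 2 with n
    calc ∫⁻ x, ⨆ i, ‖u (i + n) x‖ₑ ∂μ
        = ∫⁻ x, ⨆ k, partialSups (fun i => ‖u (i + n) x‖ₑ) k ∂μ := by
          simp only [iSup_partialSups_eq]
      _ = ⨆ k, ∫⁻ x, partialSups (fun i => ‖u (i + n) x‖ₑ) k ∂μ :=
          lintegral_iSup (hmP n) fun _ _ hkl _ => (partialSups _).monotone hkl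
      _ = ⨆ k, ‖partialSups (fun i => |u (i + n)|) k‖ₑ := by
          congr! 2 with k
          rw [Lp.enorm_def, eLpNorm_one_eq_lintegral_enorm]
          exact lintegral_congr_ae
            ((enorm_partialSups_abs_coeFn (fun i => u (i + n)) k).mono fun _ hx => hx.symm)
  · intro m n hmn x
    refine iSup_le fun i => le_iSup_of_le (i + (n - m)) ?_
    rw [show i + (n - m) + m = i + n by omega]
  · refine ne_top_of_le_ne_top (L1.integrable_coeFn g).2.ne (lintegral_mono_ae ?_)
    have hdom : ∀ n, ∀ᵐ x ∂μ, ‖u n x‖ₑ ≤ ‖g x‖ₑ := fun n => by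
      filter_upwards [Lp.coeFn_abs (u n), (Lp.coeFn_le _ _).2 (hmaj n)] with x h₁ h₂
      rw [Real.enorm_eq_ofReal_abs, Real.enorm_eq_ofReal_abs]
      exact ENNReal.ofReal_le_ofReal ((h₁ ▸ h₂).trans (le_abs_self _))
    filter_upwards [ae_all_iff.2 hdom] with x hx
    exact iSup_le fun i => hx _

theorem ae_tendsto_zero_iff_iInf_iSup_enorm {X : Type*} [MeasurableSpace X] {μ : Measure X}
    (u : ℕ → Lp ℝ 1 μ) (g : Lp ℝ 1 μ) (hmaj : ∀ n, |u n| ≤ g) :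
    (∀ᵐ x ∂μ, Tendsto (fun n => u n x) atTop (𝓝 0)) ↔
      ⨅ n, ⨆ k, ‖partialSups (fun i => |u (i + n)|) k‖ₑ = 0 := by
  rw [← lintegral_limsup_enorm_eq u g hmaj,
    lintegral_eq_zero_iff (.limsup fun n => (Lp.stronglyMeasurable (u n)).enorm)]
  refine eventually_congr (.of_forall fun x => ?_)
  rw [tendsto_zero_iff_enorm_tendsto_zero]
  refine ⟨fun h => h.limsup_eq, fun h => ?_⟩
  exact tendsto_of_le_liminf_of_limsup_le bot_le (le_of_eq h)

/-- **Markov embeddings preserve dominated a.e. convergence to 0.** Let `Φ : L¹(μ₁) → L¹(μ₂)`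
be a Markov embedding between probability spaces (a positive linear operator mapping `𝟙` to
`𝟙`, preserving integrals, and satisfying `|Φh| = Φ|h|`), and let `(f n)` be a sequence in
`L¹(μ₁)` majorized by some `g ∈ L¹(μ₁)`.  Then `f n → 0` pointwise `μ₁`-a.e. iff
`Φ (f n) → 0` pointwise `μ₂`-a.e. -/
theorem markov_embedding_ae_convergence_iff
    {X₁ X₂ : Type*} [MeasurableSpace X₁] [MeasurableSpace X₂]
    (μ₁ : Measure X₁) (μ₂ : Measure X₂)
    [IsProbabilityMeasure μ₁] [IsProbabilityMeasure μ₂]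
    (Φ : Lp ℝ 1 μ₁ →ₗ[ℝ] Lp ℝ 1 μ₂)
    (hpos : ∀ h : Lp ℝ 1 μ₁, 0 ≤ h → 0 ≤ Φ h)
    (hone : Φ (indicatorConstLp 1 MeasurableSet.univ (measure_ne_top μ₁ Set.univ) (1 : ℝ)) =
      indicatorConstLp 1 MeasurableSet.univ (measure_ne_top μ₂ Set.univ) (1 : ℝ))
    (hint : ∀ h : Lp ℝ 1 μ₁, ∫ x, (Φ h) x ∂μ₂ = ∫ x, h x ∂μ₁)
    (habs : ∀ h : Lp ℝ 1 μ₁, |Φ h| = Φ |h|)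
    (f : ℕ → Lp ℝ 1 μ₁) (g : Lp ℝ 1 μ₁) (hmaj : ∀ n, |f n| ≤ g) :
    (∀ᵐ x ∂μ₁, Tendsto (fun n => (f n) x) atTop (𝓝 0)) ↔
      (∀ᵐ x ∂μ₂, Tendsto (fun n => (Φ (f n)) x) atTop (𝓝 0)) := by
  have hmaj' (n : ℕ) : |Φ (f n)| ≤ Φ g := by
    rw [habs, ← sub_nonneg, ← map_sub]
    exact hpos _ (sub_nonneg.2 (hmaj n))
  rw [ae_tendsto_zero_iff_iInf_iSup_enorm f g hmaj,
    ae_tendsto_zero_iff_iInf_iSup_enorm (fun n => Φ (f n)) (Φ g) hmaj']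
  simp only [habs, ← map_partialSups_of_map_abs Φ habs, enorm_map_of_map_abs Φ hint habs]
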